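/- arXiv:0810.0383 — 2 statements merged into one kernel-verified Lean document; each statement's English description precedes it below -/
import Mathlib

section
/- Let n ≥ 1 and let x₁, …, xₙ ∈ ℂ[X] be polynomials such that for every tuple of integers (m₁, …, mₙ) ∈ ℤⁿ, not all zero, the polynomial m₁x₁ + ⋯ + mₙxₙ is nonconstant. Then the n + 1 entire functions z ↦ z, z ↦ exp(x₁(z)), …, z ↦ exp(xₙ(z)), regarded as elements of the ring of functions ℂ → ℂ with pointwise operations, are algebraically independent over ℂ. In particular, the functions exp(x₁(z)), …, exp(xₙ(z)) are algebraically independent over the field ℂ(z) of rational functions. -/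
section

open Polynomial

/-- The derivative of `p * exp q` is `twistedDerivative q p * exp q`. -/
noncomputable def twistedDerivative (q p : ℂ[X]) : ℂ[X] :=
  derivative p + derivative q * p

theorem eq_zero_of_twistedDerivative_eq_zero {q p : ℂ[X]} (hq : 0 < q.natDegree)
    (h : twistedDerivative q p = 0) : p = 0 := by
  by_contra hp
  have hq' : derivative q ≠ 0 := fun h0 => hq.ne' (derivative_eq_zero.mp h0)
  have h1 : (derivative p).degree < p.degree := degree_derivative_lt hp
  have h2 : derivative p = -(derivative q * p) := eq_neg_of_add_eq_zero_left h
  rw [h2, degree_neg, mul_comm] at h1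
  exact absurd h1 (not_lt.mpr (degree_le_mul_left p hq'))

theorem eq_zero_of_iterate_twistedDerivative_eq_zero {q p : ℂ[X]} (hq : 0 < q.natDegree) (N : ℕ)
    (h : (twistedDerivative q)^[N] p = 0) : p = 0 := by
  induction N with
  | zero => exact h
  | succ N ih =>
    rw [Function.iterate_succ_apply'] at h
    exact ih (eq_zero_of_twistedDerivative_eq_zero hq h)

theorem twistedDerivative_zero_left : twistedDerivative 0 = derivative := by
  ext1 p
  simp [twistedDerivative]

theorem hasDerivAt_eval_mul_exp_eval (q p : ℂ[X]) (z : ℂ) :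
    HasDerivAt (fun w => p.eval w * Complex.exp (q.eval w))
      ((twistedDerivative q p).eval z * Complex.exp (q.eval z)) z := by
  refine ((p.hasDerivAt z).mul (q.hasDerivAt z).cexp).congr_deriv ?_
  simp only [twistedDerivative, eval_add, eval_mul]
  ring

theorem sum_iterate_twistedDerivative_mul_exp_eq_zero {ι : Type*} (s : Finset ι) (q p : ι → ℂ[X])
    (h : ∀ z : ℂ, ∑ i ∈ s, (p i).eval z * Complex.exp ((q i).eval z) = 0) (N : ℕ) (z : ℂ) :
    ∑ i ∈ s, ((twistedDerivative (q i))^[N] (p i)).eval z * Complex.exp ((q i).eval z) = 0 := by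
  induction N generalizing z with
  | zero => exact h z
  | succ N ih =>
    simp only [Function.iterate_succ_apply']
    refine (HasDerivAt.fun_sum fun i _ => hasDerivAt_eval_mul_exp_eval (q i) _ z).unique ?_
    simp only [ih]
    exact hasDerivAt_const z 0

/-- Exponentials of polynomials that are pairwise distinct modulo constants are linearly
independent over `ℂ[X]`. -/
theorem eq_zero_of_sum_mul_exp_eq_zero {ι : Type*} (s : Finset ι) (q p : ι → ℂ[X])
    (hq : ∀ i ∈ s, ∀ j ∈ s, i ≠ j → 0 < (q i - q j).natDegree)
    (h : ∀ z : ℂ, ∑ i ∈ s, (p i).eval z * Complex.exp ((q i).eval z) = 0) :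
    ∀ i ∈ s, p i = 0 := by
  classical
  induction s using Finset.induction_on generalizing q p with
  | empty => simp
  | insert a t ha ih =>
    have hshift : ∀ z : ℂ, ∑ i ∈ insert a t,
        (p i).eval z * Complex.exp ((q i - q a).eval z) = 0 := fun z => by
      simp only [eval_sub, Complex.exp_sub, ← mul_div_assoc, ← Finset.sum_div, h z, zero_div]
    have hne : ∀ i ∈ t, i ≠ a := fun i hi hia => ha (hia ▸ hi)
    have ht : ∀ i ∈ t, p i = 0 := by
      set N := (p a).natDegree + 1
      have hN := sum_iterate_twistedDerivative_mul_exp_eq_zero _ _ _ hshift N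
      simp only [Finset.sum_insert ha, sub_self, twistedDerivative_zero_left,
        iterate_derivative_eq_zero (Nat.lt_succ_self (p a).natDegree), N, eval_zero, zero_mul,
        zero_add] at hN
      intro i hi
      refine eq_zero_of_iterate_twistedDerivative_eq_zero
        (hq i (Finset.mem_insert_of_mem hi) a (Finset.mem_insert_self a t) (hne i hi)) N ?_
      refine ih (fun i => q i - q a) _ (fun i hi j hj hij => ?_) hN i hi
      simpa only [sub_sub_sub_cancel_right] using
        hq i (Finset.mem_insert_of_mem hi) j (Finset.mem_insert_of_mem hj) hij
    have hpa : p a = 0 := by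
      refine Polynomial.funext fun z => ?_
      have hz := hshift z
      rw [Finset.sum_insert ha, Finset.sum_eq_zero fun i hi => by simp [ht i hi]] at hz
      simpa using hz
    intro i hi
    rcases Finset.mem_insert.mp hi with rfl | hi
    exacts [hpa, ht i hi]

end

/-- **Lindemann–Weierstrass over `ℂ(z)` for exponentials of polynomials** (Ax; the constant
toric case of Corollary 1.1). If `x₁, …, xₙ ∈ ℂ[X]` are polynomials such that every
nontrivial integral linear combination `m₁x₁ + ⋯ + mₙxₙ` is nonconstant, then the `n + 1`
functions `z`, `exp (x₁ z)`, …, `exp (xₙ z)`, viewed as elements of the ring `ℂ → ℂ` of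
functions with pointwise operations, are algebraically independent over `ℂ`.
(In particular, `exp (x₁ z), …, exp (xₙ z)` are algebraically independent over `ℂ(z)`.) -/
theorem algebraicIndependent_exp_polynomial
    (n : ℕ) (hn : 1 ≤ n) (x : Fin n → Polynomial ℂ)
    (hx : ∀ m : Fin n → ℤ, m ≠ 0 → 0 < (∑ i, m i • x i).natDegree) :
    AlgebraicIndependent ℂ
      (Fin.cons (fun z : ℂ => z)
        (fun i => fun z : ℂ => Complex.exp ((x i).eval z)) :
        Fin (n + 1) → ℂ → ℂ) := by
  classical
  rw [algebraicIndependent_iff]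
  intro F hF
  let P : (Fin n →₀ ℕ) → Polynomial ℂ := fun d =>
    ∑ e ∈ F.support with e.tail = d, Polynomial.monomial (e 0) (F.coeff e)
  let Q : (Fin n →₀ ℕ) → Polynomial ℂ := fun d => ∑ i, d i • x i
  have hP : ∀ d ∈ F.support.image Finsupp.tail, P d = 0 := by
    refine eq_zero_of_sum_mul_exp_eq_zero _ Q P (fun d _ d' _ hd => ?_) fun z => ?_
    · have hm : (fun i => (d i : ℤ) - d' i) ≠ 0 := fun h0 => hd <| Finsupp.ext fun i => by
        have := congrFun h0 i
        simp only [Pi.zero_apply] at this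
        omega
      simpa [Q, sub_smul, Finset.sum_sub_distrib] using hx _ hm
    · have hz := congrFun hF z
      rw [MvPolynomial.aeval_eq_eval₂Hom, MvPolynomial.coe_eval₂Hom, MvPolynomial.eval₂_eq',
        Finset.sum_apply, ← Finset.sum_fiberwise_of_maps_to
          (fun e he => Finset.mem_image_of_mem Finsupp.tail he)] at hz
      refine Eq.trans ?_ hz
      refine Finset.sum_congr rfl fun d _ => ?_
      simp only [P, Polynomial.eval_finsetSum, Finset.sum_mul]
      refine Finset.sum_congr rfl fun e he => ?_
      rw [← (Finset.mem_filter.mp he).2]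
      simp [Q, Polynomial.eval_finsetSum, Fin.prod_univ_succ, Complex.exp_sum,
        Complex.exp_nat_mul, Finsupp.tail_apply, mul_assoc]
  by_contra hF0
  obtain ⟨e, he⟩ := MvPolynomial.support_nonempty.mpr hF0
  have hcoeff := congrArg (fun r => Polynomial.coeff r (e 0))
    (hP e.tail (Finset.mem_image_of_mem _ he))
  simp only [P, Polynomial.finsetSum_coeff, Polynomial.coeff_monomial,
    Polynomial.coeff_zero] at hcoeff
  rw [Finset.sum_eq_single_of_mem e (by simpa using he), if_pos rfl] at hcoeff
  · exact MvPolynomial.mem_support_iff.mp he hcoeff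
  · intro e' he' hne
    refine if_neg fun h0 => hne ?_
    rw [← Finsupp.cons_tail e, ← Finsupp.cons_tail e', h0, (Finset.mem_filter.mp he').2]
end

section
/- Let U ⊆ ℂ be a nonempty connected open set, let n ≥ 1, and let x₁, …, xₙ : U → ℂ be analytic functions each of which is algebraic over ℂ(z), i.e. for each i there is a nonzero two-variable polynomial Pᵢ ∈ ℂ[X, Y] with Pᵢ(z, xᵢ(z)) = 0 for all z ∈ U. Assume that for every tuple of integers (m₁, …, mₙ) ∈ ℤⁿ, not all zero, the analytic function z ↦ m₁x₁(z) + ⋯ + mₙxₙ(z) is nonconstant on U. Then there is no nonzero polynomial Q ∈ ℂ[X₀, X₁, …, Xₙ] in n + 1 variables such that Q(z, exp(x₁(z)), …, exp(xₙ(z))) = 0 for all z ∈ U. Equivalently, the analytic functions exp∘x₁, …, exp∘xₙ are algebraically independent over ℂ(z) on U. -/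
open Algebra in
/-- Two elements algebraic over `k[t]` are algebraically dependent over `k`. -/
theorem not_algebraicIndependent_pair_of_isAlgebraic_adjoin_singleton {k A : Type*} [Field k]
    [CommRing A] [IsDomain A] [Algebra k A] {t a b : A}
    (ha : IsAlgebraic (adjoin k {t}) a) (hb : IsAlgebraic (adjoin k {t}) b) :
    ¬ AlgebraicIndependent k ![a, b] := by
  intro h
  let R := adjoin k {t}
  let B := Subalgebra.algebraicClosure R A
  let v : Fin 2 → B := ![⟨a, ha⟩, ⟨b, hb⟩]
  have hv : AlgebraicIndependent k v := by
    refine AlgebraicIndependent.of_comp ((Subalgebra.val B).restrictScalars k) ?_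
    convert h using 1
    ext i
    fin_cases i <;> rfl
  have h2 := hv.lift_cardinalMk_le_trdeg
  have : FaithfulSMul R B := (faithfulSMul_iff_algebraMap_injective R B).2 fun r s hrs ↦
    Subtype.ext (congrArg (fun c : B ↦ (c : A)) hrs)
  have hadd : trdeg k R + trdeg R B = trdeg k B := trdeg_add_eq k R
  have hRB : trdeg R B = 0 := trdeg_eq_zero
  have hR : trdeg k R ≤ 1 := by
    have hsurj : Function.Surjective
        (Polynomial.aeval (R := k) (A := R) ⟨t, self_mem_adjoin_singleton k t⟩) := by
      rintro ⟨y, hy⟩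
      obtain ⟨p, hp⟩ := (adjoin_singleton_eq_range_aeval k t).le hy
      refine ⟨p, Subtype.ext ?_⟩
      rw [← Subalgebra.coe_val, ← Polynomial.aeval_algHom_apply]
      exact hp
    simpa [Polynomial.trdeg_of_isDomain] using lift_trdeg_le_of_surjective _ hsurj
  rw [← hadd, hRB, add_zero] at h2
  have h3 := h2.trans (Cardinal.lift_le.2 hR)
  simp at h3

/-- In characteristic zero, elements algebraic over a subalgebra are stable under a derivation
as soon as the derivation maps the subalgebra to algebraic elements. -/
theorem Derivation.isAlgebraic_apply {k A : Type*} [Field k] [CharZero k] [CommRing A] [IsDomain A]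
    [Algebra k A] (D : Derivation k A A) {R : Subalgebra k A}
    (hD : ∀ r ∈ R, IsAlgebraic R (D r)) {a : A} (ha : IsAlgebraic R a) : IsAlgebraic R (D a) := by
  have key : ∀ p : Polynomial R, ∃ c : A, IsAlgebraic R c ∧
      D (p.aeval a) = c + p.derivative.aeval a * D a := by
    intro p
    induction p using Polynomial.induction_on' with
    | add p q hp hq =>
      obtain ⟨c, hc, hpc⟩ := hp
      obtain ⟨d, hd, hqd⟩ := hq
      refine ⟨c + d, hc.add hd, ?_⟩
      simp only [map_add, hpc, hqd]
      ring
    | monomial n r =>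
      refine ⟨a ^ n * D r, (ha.pow n).mul (hD r r.2), ?_⟩
      rw [Polynomial.derivative_monomial, Polynomial.aeval_monomial, Polynomial.aeval_monomial,
        D.leibniz, D.leibniz_pow]
      have hr : algebraMap R A r = r := rfl
      have hrn : algebraMap R A (r * (n : R)) = r * n := by simp
      rw [hr, hrn]
      simp only [smul_eq_mul, nsmul_eq_mul]
      ring
  obtain ⟨p, ⟨hp0, hpa⟩, hmin⟩ := WellFounded.has_min
    (measure (Polynomial.natDegree (R := R))).wf {p | p ≠ 0 ∧ p.aeval a = 0} ha
  have hp' : p.derivative.aeval a ≠ 0 := by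
    intro h0
    have hdeg : p.natDegree ≠ 0 := by
      intro hdeg
      rw [Polynomial.eq_C_of_natDegree_eq_zero hdeg, Polynomial.aeval_C] at hpa
      apply hp0
      rw [Polynomial.eq_C_of_natDegree_eq_zero hdeg, Subtype.ext (a1 := p.coeff 0) (a2 := 0) hpa,
        Polynomial.C_0]
    have : CharZero A := charZero_of_injective_algebraMap (algebraMap k A).injective
    refine hmin p.derivative ⟨fun h ↦ hdeg ?_, h0⟩ (Polynomial.natDegree_derivative_lt hdeg)
    exact Polynomial.derivative_eq_zero.1 h
  have hB : Algebra.adjoin R {a} ≤ Subalgebra.algebraicClosure R A :=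
    Algebra.adjoin_le (Set.singleton_subset_iff.2 ha)
  obtain ⟨c, hc, h⟩ := key p
  rw [hpa, map_zero] at h
  refine IsAlgebraic.of_mul (mem_nonZeroDivisors_of_ne_zero hp')
    (hB (Polynomial.aeval_mem_adjoin_singleton R a)) ?_
  rw [← neg_eq_of_add_eq_zero_right h.symm]
  exact hc.neg

/-- Exponential-type elements `e i`, i.e. with `D (e i) = y i * e i`, are linearly independent over
a differential subalgebra `B`, provided that no two of them are proportional over `B`. -/
theorem Derivation.linearIndependent_of_apply_eq_mul {k A ι : Type*} [Field k] [CommRing A]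
    [IsDomain A] [Algebra k A] (D : Derivation k A A)
    (hconst : ∀ f g : A, g ≠ 0 → D f * g = f * D g → ∃ c : k, f = c • g)
    (B : Subalgebra k A) (hB : ∀ b ∈ B, D b ∈ B) (e y : ι → A) (he : ∀ i, e i ≠ 0)
    (hy : ∀ i, y i ∈ B) (hey : ∀ i, D (e i) = y i * e i)
    (hprop : ∀ i j, i ≠ j → ∀ c ∈ B, ∀ d ∈ B, c ≠ 0 → c * e i ≠ d * e j) :
    LinearIndependent B e := by
  classical
  have key : ∀ (s : Finset ι) (g : ι → A), (∀ i, g i ∈ B) → ∑ i ∈ s, g i * e i = 0 →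
      ∀ i ∈ s, g i = 0 := by
    intro s
    induction s using Finset.induction_on with
    | empty => simp
    | insert a s ha ih =>
      intro g hg hsum
      rw [Finset.sum_insert ha] at hsum
      have hs : ∀ i ∈ s, g i = 0 := by
        by_cases hga : g a = 0
        · exact ih g hg (by simpa [hga] using hsum)
        have hh := ih (fun i ↦ g a * (D (g i) + g i * y i) - g i * (D (g a) + g a * y a))
          (fun i ↦ B.sub_mem
            (B.mul_mem (hg a) (B.add_mem (hB _ (hg i)) (B.mul_mem (hg i) (hy i))))
            (B.mul_mem (hg i) (B.add_mem (hB _ (hg a)) (B.mul_mem (hg a) (hy a)))))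
          (by
            have hD := congrArg D hsum
            simp only [map_add, map_sum, D.leibniz, smul_eq_mul, hey, map_zero] at hD
            have h1 : ∑ i ∈ s, (g i * (y i * e i) + e i * D (g i)) =
                ∑ i ∈ s, (D (g i) + g i * y i) * e i :=
              Finset.sum_congr rfl fun i _ ↦ by ring
            rw [h1] at hD
            simp only [sub_mul, Finset.sum_sub_distrib, mul_assoc, ← Finset.mul_sum]
            have h2 : ∑ i ∈ s, g i * ((D (g a) + g a * y a) * e i) =
                (D (g a) + g a * y a) * ∑ i ∈ s, g i * e i := by
              rw [Finset.mul_sum]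
              exact Finset.sum_congr rfl fun i _ ↦ by ring
            rw [h2]
            linear_combination g a * hD - (D (g a) + g a * y a) * hsum)
        intro i hi
        by_contra hgi
        have hw := hh i hi
        have hia : a ≠ i := fun h ↦ ha (h ▸ hi)
        obtain ⟨c, hc⟩ := hconst (g a * e a) (g i * e i) (mul_ne_zero hgi (he i)) (by
          simp only [D.leibniz, smul_eq_mul, hey]
          linear_combination -(e a * e i) * hw)
        rw [← smul_mul_assoc] at hc
        exact hprop a i hia _ (hg a) _ (B.smul_mem (hg i) c) hga hc
      rw [Finset.sum_eq_zero fun i hi ↦ by rw [hs i hi, zero_mul], add_zero] at hsum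
      simp only [Finset.mem_insert, forall_eq_or_imp]
      exact ⟨(mul_eq_zero.1 hsum).resolve_right (he a), hs⟩
  rw [linearIndependent_iff']
  intro s g hsum i hi
  exact Subtype.ext (key s (fun i ↦ g i) (fun i ↦ (g i).2) hsum i hi)

/-- The algebra of functions on `U` which are restrictions of functions holomorphic on `U`. -/
def holomorphicFunctions (U : Set ℂ) : Subalgebra ℂ (U → ℂ) where
  carrier := {f | ∃ g : ℂ → ℂ, DifferentiableOn ℂ g U ∧ ∀ z : U, g z = f z}
  mul_mem' := by
    rintro f₁ f₂ ⟨g₁, hg₁, h₁⟩ ⟨g₂, hg₂, h₂⟩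
    exact ⟨g₁ * g₂, hg₁.mul hg₂, fun z ↦ by simp [h₁, h₂]⟩
  add_mem' := by
    rintro f₁ f₂ ⟨g₁, hg₁, h₁⟩ ⟨g₂, hg₂, h₂⟩
    exact ⟨g₁ + g₂, hg₁.add hg₂, fun z ↦ by simp [h₁, h₂]⟩
  algebraMap_mem' c := ⟨fun _ ↦ c, differentiableOn_const c, fun _ ↦ rfl⟩

namespace holomorphicFunctions

variable {U : Set ℂ}

/-- The restriction to `U` of a function holomorphic on `U`. -/
def mk (g : ℂ → ℂ) (hg : DifferentiableOn ℂ g U) : holomorphicFunctions U :=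
  ⟨fun z ↦ g z, g, hg, fun _ ↦ rfl⟩

@[simp]
theorem mk_apply (g : ℂ → ℂ) (hg : DifferentiableOn ℂ g U) (z : U) : (mk g hg).1 z = g z := rfl

theorem exists_eq_mk (f : holomorphicFunctions U) : ∃ g hg, f = mk g hg := by
  obtain ⟨f, g, hg, h⟩ := f
  exact ⟨g, hg, Subtype.ext (funext fun z ↦ (h z).symm)⟩

theorem ext_apply {f g : holomorphicFunctions U} (h : ∀ z : U, f.1 z = g.1 z) : f = g :=
  Subtype.ext (funext h)

theorem mk_eq_zero_iff {g : ℂ → ℂ} {hg : DifferentiableOn ℂ g U} :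
    mk g hg = 0 ↔ ∀ z ∈ U, g z = 0 :=
  ⟨fun h z hz ↦ congrFun (congrArg Subtype.val h) ⟨z, hz⟩, fun h ↦ ext_apply fun z ↦ h z z.2⟩

theorem isDomain (hU : IsOpen U) (hc : IsConnected U) : IsDomain (holomorphicFunctions U) := by
  have : Nontrivial (holomorphicFunctions U) := by
    obtain ⟨z, hz⟩ := hc.nonempty
    refine ⟨0, 1, fun h ↦ ?_⟩
    have := congrFun (congrArg Subtype.val h) ⟨z, hz⟩
    simp at this
  have : NoZeroDivisors (holomorphicFunctions U) := ⟨by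
    intro f₁ f₂ h
    obtain ⟨g₁, hg₁, rfl⟩ := exists_eq_mk f₁
    obtain ⟨g₂, hg₂, rfl⟩ := exists_eq_mk f₂
    rw [mk_eq_zero_iff, mk_eq_zero_iff]
    exact AnalyticOnNhd.eq_zero_or_eq_zero_of_mul_eq_zero (hg₁.analyticOnNhd hU)
      (hg₂.analyticOnNhd hU) (fun z hz ↦ congrFun (congrArg Subtype.val h) ⟨z, hz⟩)
      hc.isPreconnected⟩
  exact NoZeroDivisors.to_isDomain _

open Classical in
/-- The complex derivative as a derivation of the algebra of holomorphic functions on `U`. -/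
noncomputable def derivation (hU : IsOpen U) :
    Derivation ℂ (holomorphicFunctions U) (holomorphicFunctions U) := by
  let d (f : holomorphicFunctions U) : holomorphicFunctions U :=
    mk (deriv f.2.choose) (f.2.choose_spec.1.deriv hU)
  have hd : ∀ g hg (z : U), (d (mk g hg)).1 z = deriv g z := fun g hg z ↦
    Filter.EventuallyEq.deriv_eq <| Filter.eventuallyEq_of_mem (hU.mem_nhds z.2) fun w hw ↦
      (mk g hg).2.choose_spec.2 ⟨w, hw⟩
  have hdiff : ∀ {g : ℂ → ℂ}, DifferentiableOn ℂ g U → ∀ z : U, DifferentiableAt ℂ g z :=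
    fun hg z ↦ hg.differentiableAt (hU.mem_nhds z.2)
  refine Derivation.mk' { toFun := d, map_add' := ?_, map_smul' := ?_ } ?_
  · intro f₁ f₂
    obtain ⟨g₁, hg₁, rfl⟩ := exists_eq_mk f₁
    obtain ⟨g₂, hg₂, rfl⟩ := exists_eq_mk f₂
    refine ext_apply fun z ↦ (hd (g₁ + g₂) (hg₁.add hg₂) z).trans ?_
    rw [deriv_add (hdiff hg₁ z) (hdiff hg₂ z), ← hd g₁ hg₁, ← hd g₂ hg₂]
    rfl
  · intro c f
    obtain ⟨g, hg, rfl⟩ := exists_eq_mk f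
    refine ext_apply fun z ↦ (hd (c • g) (hg.const_smul c) z).trans ?_
    rw [deriv_const_smul _ (hdiff hg z), ← hd g hg]
    rfl
  · intro f₁ f₂
    obtain ⟨g₁, hg₁, rfl⟩ := exists_eq_mk f₁
    obtain ⟨g₂, hg₂, rfl⟩ := exists_eq_mk f₂
    refine ext_apply fun z ↦ (hd (g₁ * g₂) (hg₁.mul hg₂) z).trans ?_
    rw [deriv_mul (hdiff hg₁ z) (hdiff hg₂ z), ← hd g₁ hg₁, ← hd g₂ hg₂, add_comm,
      mul_comm ((d (mk g₁ hg₁)).1 z)]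
    rfl

theorem derivation_mk_apply (hU : IsOpen U) (g : ℂ → ℂ) (hg : DifferentiableOn ℂ g U) (z : U) :
    (derivation hU (mk g hg)).1 z = deriv g z :=
  Filter.EventuallyEq.deriv_eq <| Filter.eventuallyEq_of_mem (hU.mem_nhds z.2) fun w hw ↦
    (mk g hg).2.choose_spec.2 ⟨w, hw⟩

/-- Two holomorphic functions on a connected open set with vanishing Wronskian are proportional. -/
theorem exists_eq_smul_of_wronskian_eq_zero (hU : IsOpen U) (hc : IsConnected U)
    (f₁ f₂ : holomorphicFunctions U) (h₂ : f₂ ≠ 0)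
    (h : derivation hU f₁ * f₂ = f₁ * derivation hU f₂) : ∃ c : ℂ, f₁ = c • f₂ := by
  obtain ⟨g₁, hg₁, rfl⟩ := exists_eq_mk f₁
  obtain ⟨g₂, hg₂, rfl⟩ := exists_eq_mk f₂
  rw [Ne, mk_eq_zero_iff] at h₂
  push Not at h₂
  obtain ⟨z₀, hz₀, hne⟩ := h₂
  have hW : ∀ z ∈ U, deriv g₁ z * g₂ z = g₁ z * deriv g₂ z := fun z hz ↦ by
    have := congrFun (congrArg Subtype.val h) ⟨z, hz⟩
    simpa [derivation_mk_apply] using this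
  have hnhds : U ∩ {z | g₂ z ≠ 0} ∈ nhds z₀ := Filter.inter_mem (hU.mem_nhds hz₀)
    ((hg₂.continuousOn.continuousAt (hU.mem_nhds hz₀)).eventually_ne hne)
  obtain ⟨r, hr, hball⟩ := Metric.mem_nhds_iff.1 hnhds
  have hdiff : ∀ {g : ℂ → ℂ}, DifferentiableOn ℂ g U → ∀ z ∈ Metric.ball z₀ r,
    DifferentiableAt ℂ g z := fun hg z hz ↦ hg.differentiableAt (hU.mem_nhds (hball hz).1)
  have hconst : ∀ z ∈ Metric.ball z₀ r, g₁ z / g₂ z = g₁ z₀ / g₂ z₀ := fun z hz ↦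
    Metric.isOpen_ball.is_const_of_deriv_eq_zero (convex_ball z₀ r).isPreconnected
      (f := fun z ↦ g₁ z / g₂ z)
      (fun w hw ↦ ((hdiff hg₁ w hw).div (hdiff hg₂ w hw) (hball hw).2).differentiableWithinAt)
      (fun w hw ↦ by
        rw [deriv_fun_div (hdiff hg₁ w hw) (hdiff hg₂ w hw) (hball hw).2, hW w (hball hw).1,
          sub_self, zero_div]
        rfl)
      hz (Metric.mem_ball_self hr)
  refine ⟨g₁ z₀ / g₂ z₀, ext_apply fun z ↦ ?_⟩
  refine (hg₁.analyticOnNhd hU).eqOn_of_preconnected_of_eventuallyEq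
    ((hg₂.const_smul (g₁ z₀ / g₂ z₀)).analyticOnNhd hU) hc.isPreconnected hz₀ ?_ z.2
  filter_upwards [Metric.ball_mem_nhds z₀ hr] with w hw
  rw [Pi.smul_apply, smul_eq_mul, ← hconst w hw, div_mul_cancel₀ _ (hball hw).2]

/-- The exponential of a holomorphic function. -/
noncomputable def exp (f : holomorphicFunctions U) : holomorphicFunctions U :=
  ⟨fun z ↦ Complex.exp (f.1 z), by
    obtain ⟨g, hg, h⟩ := f.2
    exact ⟨fun z ↦ Complex.exp (g z), hg.cexp, fun z ↦ congrArg Complex.exp (h z)⟩⟩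

theorem exp_add (f g : holomorphicFunctions U) : exp (f + g) = exp f * exp g :=
  ext_apply fun _ ↦ Complex.exp_add _ _

theorem exp_sum {ι : Type*} (s : Finset ι) (f : ι → holomorphicFunctions U) :
    exp (∑ i ∈ s, f i) = ∏ i ∈ s, exp (f i) := by
  classical
  induction s using Finset.induction_on with
  | empty => exact ext_apply fun z ↦ Complex.exp_zero
  | insert a s ha ih => rw [Finset.sum_insert ha, Finset.prod_insert ha, exp_add, ih]

theorem exp_nsmul (n : ℕ) (f : holomorphicFunctions U) : exp (n • f) = exp f ^ n := by
  rw [← Finset.card_range n, ← Finset.sum_const, exp_sum, Finset.prod_const]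

theorem exp_ne_zero (hU : U.Nonempty) (f : holomorphicFunctions U) : exp f ≠ 0 := fun h ↦ by
  obtain ⟨z, hz⟩ := hU
  exact Complex.exp_ne_zero _ (congrFun (congrArg Subtype.val h) ⟨z, hz⟩)

theorem derivation_exp (hU : IsOpen U) (f : holomorphicFunctions U) :
    derivation hU (exp f) = derivation hU f * exp f := by
  obtain ⟨g, hg, rfl⟩ := exists_eq_mk f
  refine ext_apply fun z ↦ ?_
  refine (derivation_mk_apply hU _ hg.cexp z).trans ?_
  rw [deriv_cexp (hg.differentiableAt (hU.mem_nhds z.2)), mul_comm, ← derivation_mk_apply hU g hg]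
  rfl

theorem aeval_apply {σ : Type*} (f : σ → holomorphicFunctions U) (p : MvPolynomial σ ℂ) (z : U) :
    (MvPolynomial.aeval f p).1 z = MvPolynomial.eval (fun i ↦ (f i).1 z) p := by
  have h := MvPolynomial.map_aeval f
    ((Pi.evalRingHom (fun _ : U ↦ ℂ) z).comp (holomorphicFunctions U).val.toRingHom) p
  exact h

variable (U) in
/-- The coordinate function. -/
def coord : holomorphicFunctions U := mk id differentiableOn_id

/-- The coordinate function has derivative one. -/
theorem derivation_coord (hU : IsOpen U) : derivation hU (coord U) = 1 :=
  ext_apply fun z ↦ (derivation_mk_apply hU _ _ z).trans (deriv_id _)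

theorem transcendental_coord (hU : IsOpen U) (hne : U.Nonempty) : Transcendental ℂ (coord U) := by
  rintro ⟨p, hp0, hp⟩
  obtain ⟨z₀, hz₀⟩ := hne
  refine hp0 (p.eq_zero_of_infinite_isRoot
    ((infinite_of_mem_nhds z₀ (hU.mem_nhds hz₀)).mono fun z hz ↦ ?_))
  have h := Polynomial.hom_eval₂ p (algebraMap ℂ (holomorphicFunctions U))
    ((Pi.evalRingHom (fun _ : U ↦ ℂ) ⟨z, hz⟩).comp (holomorphicFunctions U).val.toRingHom)
    (coord U)
  rw [← Polynomial.aeval_def, hp, map_zero] at h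
  exact h.symm

end holomorphicFunctions

/-- The exponential function is transcendental: no nonzero two-variable polynomial vanishes on its
graph over a nonempty open set. -/
theorem Complex.eq_zero_of_eval_exp_eq_zero {V : Set ℂ} (hV : IsOpen V) (hne : V.Nonempty)
    (R : MvPolynomial (Fin 2) ℂ) (hR : ∀ t ∈ V, MvPolynomial.eval ![t, exp t] R = 0) : R = 0 := by
  have heval : ∀ a s : ℂ, (MvPolynomial.aeval ![Polynomial.X, Polynomial.C s] R).eval a =
      MvPolynomial.eval ![a, s] R := fun a s ↦
    (MvPolynomial.map_aeval ![Polynomial.X, Polynomial.C s] (Polynomial.evalRingHom a) R).trans <|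
      MvPolynomial.eval₂Hom_congr (RingHom.ext fun _ ↦ Polynomial.eval_C)
        (funext fun i ↦ by fin_cases i <;> simp) rfl
  have hdiff : Differentiable ℂ fun t ↦ MvPolynomial.eval ![t, exp t] R := by
    clear hR heval
    induction R using MvPolynomial.induction_on with
    | C a => simp
    | add p q hp hq => simpa only [map_add] using hp.fun_add hq
    | mul_X p i hp =>
      simp only [map_mul, MvPolynomial.eval_X]
      refine hp.mul ?_
      fin_cases i
      · exact differentiable_id
      · exact differentiable_exp
  obtain ⟨t₀, ht₀⟩ := hne
  have hall : ∀ t, MvPolynomial.eval ![t, exp t] R = 0 := fun t ↦ by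
    have hana := hdiff.differentiableOn.analyticOnNhd isOpen_univ
    refine hana.eqOn_zero_of_preconnected_of_eventuallyEq_zero
      isPreconnected_univ (Set.mem_univ t₀) ?_ (Set.mem_univ t)
    filter_upwards [hV.mem_nhds ht₀] with t ht using hR t ht
  have hzero : ∀ s ≠ 0, ∀ a, MvPolynomial.eval ![a, s] R = 0 := by
    intro s hs a
    have h0 : MvPolynomial.aeval ![Polynomial.X, Polynomial.C s] R = (0 : Polynomial ℂ) := by
      refine Polynomial.eq_zero_of_infinite_isRoot _ (Set.infinite_of_injective_forall_mem
        (f := fun k : ℤ ↦ log s + k * (2 * Real.pi * I)) ?_ ?_)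
      · intro k l hkl
        simpa [Real.pi_ne_zero] using hkl
      · intro k
        rw [Set.mem_ofPred_eq, Polynomial.IsRoot, heval]
        have := hall (log s + k * (2 * Real.pi * I))
        rwa [exp_add, exp_log hs, exp_int_mul_two_pi_mul_I, mul_one] at this
    rw [← heval, h0, Polynomial.eval_zero]
  refine MvPolynomial.funext_set (s := fun _ ↦ {0}ᶜ)
    (fun _ ↦ (Set.finite_singleton (0 : ℂ)).infinite_compl) fun x hx ↦ ?_
  rw [map_zero, ← hzero (x 1) (hx 1 trivial) (x 0)]
  congr 2
  ext i
  fin_cases i <;> rfl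

namespace holomorphicFunctions

variable {U : Set ℂ}

/-- If `w` and `exp w` are both algebraic over `ℂ[z]`, then `w` is constant. -/
theorem exists_eq_const_of_isAlgebraic_exp (hU : IsOpen U) (hc : IsConnected U)
    (w : holomorphicFunctions U) (hw : IsAlgebraic (Algebra.adjoin ℂ {coord U}) w)
    (he : IsAlgebraic (Algebra.adjoin ℂ {coord U}) (exp w)) : ∃ c : ℂ, ∀ z : U, w.1 z = c := by
  have := isDomain hU hc
  have hdep := not_algebraicIndependent_pair_of_isAlgebraic_adjoin_singleton hw he
  rw [algebraicIndependent_iff] at hdep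
  push Not at hdep
  obtain ⟨R, hR, hR0⟩ := hdep
  obtain ⟨g, hg, rfl⟩ := exists_eq_mk w
  rcases (hg.analyticOnNhd hU).is_constant_or_isOpen hc.isPreconnected with ⟨c, h⟩ | h
  · exact ⟨c, fun z ↦ h z z.2⟩
  refine absurd (Complex.eq_zero_of_eval_exp_eq_zero (h U subset_rfl hU) (hc.nonempty.image g) R ?_)
    hR0
  rintro _ ⟨z, hz, rfl⟩
  have := congrFun (congrArg Subtype.val hR) ⟨z, hz⟩
  rw [aeval_apply] at this
  refine Eq.trans ?_ this
  congr 2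
  ext i
  fin_cases i <;> rfl

/-- The subalgebra of holomorphic functions on `U` that are algebraic over `ℂ[z]`. -/
noncomputable def algebraicFunctions (U : Set ℂ) [IsDomain (holomorphicFunctions U)] :
    Subalgebra ℂ (holomorphicFunctions U) :=
  (Subalgebra.algebraicClosure (Algebra.adjoin ℂ {coord U})
    (holomorphicFunctions U)).restrictScalars ℂ

section

variable [IsDomain (holomorphicFunctions U)]

theorem mem_algebraicFunctions {f : holomorphicFunctions U} :
    f ∈ algebraicFunctions U ↔ IsAlgebraic (Algebra.adjoin ℂ {coord U}) f := Iff.rfl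

theorem coord_mem_algebraicFunctions : coord U ∈ algebraicFunctions U :=
  isAlgebraic_algebraMap
    (⟨coord U, Algebra.self_mem_adjoin_singleton ℂ _⟩ : Algebra.adjoin ℂ {coord U})

theorem derivation_mem_algebraicFunctions (hU : IsOpen U) {f : holomorphicFunctions U}
    (hf : f ∈ algebraicFunctions U) : derivation hU f ∈ algebraicFunctions U := by
  refine (derivation hU).isAlgebraic_apply (fun r hr ↦ ?_) hf
  change derivation hU r ∈ algebraicFunctions U
  rw [Algebra.adjoin_singleton_eq_range_aeval] at hr
  obtain ⟨p, rfl⟩ := hr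
  change derivation hU (Polynomial.aeval (coord U) p) ∈ _
  rw [Derivation.map_aeval, derivation_coord, smul_eq_mul, mul_one]
  exact Algebra.adjoin_le (Set.singleton_subset_iff.2 coord_mem_algebraicFunctions)
    (Polynomial.aeval_mem_adjoin_singleton ℂ (coord U))

theorem mem_algebraicFunctions_of_eval_eq_zero (hU : IsOpen U) (hne : U.Nonempty)
    {f : holomorphicFunctions U} {P : MvPolynomial (Fin 2) ℂ} (hP : P ≠ 0)
    (h : ∀ z : U, MvPolynomial.eval ![(z : ℂ), f.1 z] P = 0) : f ∈ algebraicFunctions U := by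
  rw [mem_algebraicFunctions]
  by_contra hf
  have hcoord : AlgebraicIndependent ℂ (fun _ : Unit ↦ coord U) :=
    (algebraicIndependent_unique_type_iff (R := ℂ)).2 (transcendental_coord hU hne)
  have hopt : AlgebraicIndependent ℂ (fun o : Option Unit ↦ o.elim f fun _ ↦ coord U) :=
    (hcoord.option_iff_transcendental f).2 (by rwa [Set.range_const])
  have hpair : AlgebraicIndependent ℂ ![coord U, f] := by
    let e : Fin 2 → Option Unit := ![some (), none]
    have he : Function.Injective e := by decide
    convert hopt.comp e he using 1
    ext i
    fin_cases i <;> rfl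
  refine hP (algebraicIndependent_iff.1 hpair P (ext_apply fun z ↦ ?_))
  rw [aeval_apply]
  refine Eq.trans ?_ (h z)
  congr 2
  ext i
  fin_cases i <;> rfl

/-- Exponentials of algebraic functions that are pairwise distinct modulo constants are linearly
independent over the algebraic functions. -/
theorem linearIndependent_exp (hU : IsOpen U) (hc : IsConnected U) {ι : Type*}
    (y : ι → holomorphicFunctions U) (hy : ∀ i, y i ∈ algebraicFunctions U)
    (hne : ∀ i j, i ≠ j → ¬ ∃ c : ℂ, ∀ z : U, (y i - y j).1 z = c) :
    LinearIndependent (algebraicFunctions U) fun i ↦ exp (y i) := by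
  refine (derivation hU).linearIndependent_of_apply_eq_mul
    (exists_eq_smul_of_wronskian_eq_zero hU hc) _ (fun b ↦ derivation_mem_algebraicFunctions hU)
    _ (fun i ↦ derivation hU (y i)) (fun i ↦ exp_ne_zero hc.nonempty _)
    (fun i ↦ derivation_mem_algebraicFunctions hU (hy i)) (fun i ↦ derivation_exp hU _) ?_
  intro i j hij c hcB d hdB hc0 h
  refine hne i j hij (exists_eq_const_of_isAlgebraic_exp hU hc _
    ((algebraicFunctions U).sub_mem (hy i) (hy j)) ?_)
  refine IsAlgebraic.of_mul (mem_nonZeroDivisors_of_ne_zero hc0) hcB ?_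
  rw [← sub_add_cancel (y i) (y j), exp_add, ← mul_assoc] at h
  rwa [mul_right_cancel₀ (exp_ne_zero hc.nonempty _) h]

/-- Exponentials of algebraic functions that are `ℤ`-linearly independent modulo constants are
algebraically independent over the algebraic functions. -/
theorem algebraicIndependent_exp (hU : IsOpen U) (hc : IsConnected U) {ι : Type*} [Fintype ι]
    (x : ι → holomorphicFunctions U) (hx : ∀ i, x i ∈ algebraicFunctions U)
    (hne : ∀ m : ι → ℤ, m ≠ 0 → ¬ ∃ c : ℂ, ∀ z : U, ∑ i, (m i : ℂ) * (x i).1 z = c) :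
    AlgebraicIndependent (algebraicFunctions U) fun i ↦ exp (x i) := by
  have hlin := linearIndependent_exp hU hc (fun m : ι →₀ ℕ ↦ ∑ i, m i • x i)
    (fun m ↦ sum_mem fun i _ ↦ nsmul_mem (hx i) _) (by
      rintro m m' hmm ⟨c, hcst⟩
      refine hne (fun i ↦ (m i : ℤ) - m' i) (fun h ↦ hmm (Finsupp.ext fun i ↦ ?_))
        ⟨c, fun z ↦ ?_⟩
      · exact_mod_cast sub_eq_zero.1 (congrFun h i)
      · rw [← hcst z]
        simp [sub_mul, Finset.sum_sub_distrib])
  rw [algebraicIndependent_iff]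
  intro p hp
  refine MvPolynomial.ext _ _ fun m ↦ ?_
  rw [MvPolynomial.aeval_def, MvPolynomial.eval₂_eq'] at hp
  by_cases hm : m ∈ p.support
  · refine linearIndependent_iff'.1 hlin p.support (fun m ↦ p.coeff m) ?_ m hm
    simp only [exp_sum, exp_nsmul]
    simpa only [Algebra.smul_def] using hp
  · exact MvPolynomial.notMem_support_iff.1 hm

end

end holomorphicFunctions

open holomorphicFunctions in
/-- **Corollary 1.1 for `B = 𝔾ₘⁿ` over the algebraic closure of `ℂ(z)`.**
Let `U ⊆ ℂ` be a nonempty connected open set and let `x₁, …, xₙ : U → ℂ` be analytic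
(i.e. complex differentiable on `U`) functions, each algebraic over `ℂ(z)` in the sense
that it satisfies a nonzero two-variable polynomial relation `Pᵢ(z, xᵢ(z)) = 0` on `U`.
Assume that every nontrivial integral linear combination `m₁x₁ + ⋯ + mₙxₙ` is nonconstant
on `U`. Then no nonzero polynomial `Q ∈ ℂ[X₀, …, Xₙ]` satisfies
`Q(z, exp (x₁ z), …, exp (xₙ z)) = 0` on `U`; that is, `exp ∘ x₁, …, exp ∘ xₙ` are
algebraically independent over `ℂ(z)` on `U`. -/
theorem algebraicIndependent_exp_algebraic_functions
    (U : Set ℂ) (hUopen : IsOpen U) (hUconn : IsConnected U)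
    (n : ℕ) (hn : 1 ≤ n)
    (x : Fin n → ℂ → ℂ)
    (hxdiff : ∀ i, DifferentiableOn ℂ (x i) U)
    (hxalg : ∀ i, ∃ P : MvPolynomial (Fin 2) ℂ, P ≠ 0 ∧
      ∀ z ∈ U, MvPolynomial.eval ![z, x i z] P = 0)
    (hx : ∀ m : Fin n → ℤ, m ≠ 0 →
      ¬ ∃ c : ℂ, ∀ z ∈ U, ∑ i, (m i : ℂ) * x i z = c)
    (Q : MvPolynomial (Fin (n + 1)) ℂ)
    (hQ : ∀ z ∈ U, MvPolynomial.eval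
      (Fin.cons z (fun i => Complex.exp (x i z))) Q = 0) :
    Q = 0 := by
  have := isDomain hUopen hUconn
  have hexp := algebraicIndependent_exp hUopen hUconn (fun i ↦ mk (x i) (hxdiff i))
    (fun i ↦ by
      obtain ⟨P, hP, h⟩ := hxalg i
      exact mem_algebraicFunctions_of_eval_eq_zero hUopen hUconn.nonempty hP fun z ↦ h z z.2)
    (by
      rintro m hm ⟨c, h⟩
      exact hx m hm ⟨c, fun z hz ↦ h ⟨z, hz⟩⟩)
  have hcoord : AlgebraicIndependent ℂ (fun _ : Unit ↦ coord U) :=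
    (algebraicIndependent_unique_type_iff (R := ℂ)).2
      (transcendental_coord hUopen hUconn.nonempty)
  have hsum := hcoord.sumElim_of_tower (by
    rintro _ ⟨_, rfl⟩
    exact ⟨⟨coord U, coord_mem_algebraicFunctions⟩, rfl⟩) hexp
  let e : Fin (n + 1) → Fin n ⊕ Unit := Fin.cons (Sum.inr ()) Sum.inl
  have he : Function.Injective e :=
    Fin.cons_injective_iff.2 ⟨by simp, Sum.inl_injective⟩
  refine algebraicIndependent_iff.1 (hsum.comp e he) Q (ext_apply fun z ↦ ?_)
  rw [aeval_apply]
  refine Eq.trans ?_ (hQ z z.2)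
  congr 2
  ext i
  refine Fin.cases ?_ (fun i ↦ ?_) i <;> rfl
end
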